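/- Let S be a finite semigroup generated by a finite alphabet X, i.e. equipped with a surjective homomorphism π : X⁺ → S. Then there exists an irreducible sofic shift 𝒳 ⊆ X^ℤ such that π is the syntactic morphism of L(𝒳) (equivalently, the kernel congruence of π is the syntactic congruence of L(𝒳)) if and only if S is a generalized group mapping semigroup with aperiodic distinguished ideal (an AGGM-semigroup). -/

import Mathlib

/-- The shift map on biinfinite sequences. -/
def shiftMap (X : Type*) : (ℤ → X) → (ℤ → X) := fun x i => x (i + 1)

/-- A subshift: a non-empty, closed, shift-invariant subset of `X^ℤ`. -/
def IsSubshift {X : Type*} [TopologicalSpace X] (𝒳 : Set (ℤ → X)) : Prop :=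
  𝒳.Nonempty ∧ IsClosed 𝒳 ∧ shiftMap X '' 𝒳 = 𝒳

/-- The finite word `x_i x_{i+1} ⋯ x_{i+n-1}` read in the point `x`. -/
def wordAt {X : Type*} (x : ℤ → X) (i : ℤ) (n : ℕ) : List X :=
  (List.range n).map fun k => x (i + k)

/-- The language of a subshift: the set of (non-empty) finite factors of its points. -/
def shiftLang {X : Type*} (𝒳 : Set (ℤ → X)) : Set (List X) :=
  {w | w ≠ [] ∧ ∃ x ∈ 𝒳, ∃ i : ℤ, w = wordAt x i w.length}

/-- A language is irreducible if any two of its members can be glued by some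
(possibly empty) middle word inside the language. -/
def IsIrreducibleLang {X : Type*} (L : Set (List X)) : Prop :=
  ∀ u ∈ L, ∀ v ∈ L, ∃ w : List X, u ++ w ++ v ∈ L

/-- `I` is a (two-sided) ideal of the semigroup `S`. -/
def IsIdealSet {S : Type*} [Semigroup S] (I : Set S) : Prop :=
  I.Nonempty ∧ ∀ a ∈ I, ∀ s : S, s * a ∈ I ∧ a * s ∈ I

/-- `I` is the minimal ideal of `S`. -/
def IsMinIdeal {S : Type*} [Semigroup S] (I : Set S) : Prop :=
  IsIdealSet I ∧ ∀ I' : Set S, IsIdealSet I' → I' ⊆ I → I' = I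

/-- `z` is a (two-sided) zero element of `S`. -/
def IsZeroElem {S : Type*} [Semigroup S] (z : S) : Prop :=
  ∀ s : S, z * s = z ∧ s * z = z

/-- `I` is a `0`-minimal ideal of `S` (with zero `z`). -/
def IsZeroMinIdeal {S : Type*} [Semigroup S] (z : S) (I : Set S) : Prop :=
  IsIdealSet I ∧ I ≠ {z} ∧ ∀ I' : Set S, IsIdealSet I' → I' ⊆ I → I' = {z} ∨ I' = I

/-- `S` acts faithfully on the left of `I`. -/
def FaithfulOnLeft {S : Type*} [Semigroup S] (I : Set S) : Prop :=
  ∀ s t : S, (∀ a ∈ I, s * a = t * a) → s = t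

/-- `S` acts faithfully on the right of `I`. -/
def FaithfulOnRight {S : Type*} [Semigroup S] (I : Set S) : Prop :=
  ∀ s t : S, (∀ a ∈ I, a * s = a * t) → s = t

/-- `G` is a subgroup (in the loose, subset sense) of the semigroup `S`. -/
def IsSubgroupSet {S : Type*} [Semigroup S] (G : Set S) : Prop :=
  G.Nonempty ∧ (∀ a ∈ G, ∀ b ∈ G, a * b ∈ G) ∧
  ∃ e ∈ G, (∀ a ∈ G, e * a = a ∧ a * e = a) ∧ ∀ a ∈ G, ∃ b ∈ G, a * b = e ∧ b * a = e

/-- A subset is aperiodic if it contains no non-trivial subgroup. -/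
def IsAperiodicSet {S : Type*} [Semigroup S] (I : Set S) : Prop :=
  ∀ G : Set S, G ⊆ I → IsSubgroupSet G → ∀ a ∈ G, ∀ b ∈ G, a = b

/-- A generalized group mapping semigroup with aperiodic distinguished ideal:
`S` acts faithfully on both sides of its minimal ideal, or on both sides of a
`0`-minimal ideal, and the ideal in question is aperiodic. -/
def IsAGGM (S : Type*) [Semigroup S] : Prop :=
  ∃ I : Set S, (IsMinIdeal I ∨ ∃ z : S, IsZeroElem z ∧ IsZeroMinIdeal z I) ∧
    FaithfulOnLeft I ∧ FaithfulOnRight I ∧ IsAperiodicSet I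

section SemigroupPart

variable {S : Type*} [Semigroup S]

/-- `spow s n = s ^ (n + 1)` in a semigroup. -/
def spow (s : S) : ℕ → S
  | 0 => s
  | n + 1 => spow s n * s

theorem spow_mul (s : S) (m n : ℕ) : spow s m * spow s n = spow s (m + n + 1) := by
  induction n with
  | zero => rfl
  | succ k ih =>
    change spow s m * (spow s k * s) = spow s (m + k + 1) * s
    rw [← mul_assoc, ih]

theorem exists_spow_idem [Finite S] (s : S) : ∃ n, spow s n * spow s n = spow s n := by
  obtain ⟨i, j, hij, h⟩ := Finite.exists_ne_map_eq_of_infinite (fun n => spow s n)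
  have key : ∀ i j : ℕ, i < j → spow s i = spow s j →
      ∃ n, spow s n * spow s n = spow s n := by
    intro i j hlt h
    obtain ⟨d, rfl⟩ : ∃ d, j = i + d + 1 := ⟨j - i - 1, by omega⟩
    have h1 : spow s i * spow s d = spow s i := by rw [spow_mul, ← h]
    have h2 : ∀ m, spow s i * spow s (d * (m + 1) + m) = spow s i := by
      intro m
      induction m with
      | zero => simpa using h1
      | succ m ih =>
        have : d * (m + 1 + 1) + (m + 1) = (d * (m + 1) + m) + d + 1 := by ring
        rw [this, ← spow_mul, ← mul_assoc, ih, h1]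
    have h3 := h2 i
    set E := d * (i + 1) + i with hE
    refine ⟨E, ?_⟩
    have hle : i ≤ E := by omega
    rcases Nat.eq_or_lt_of_le hle with he | hl
    · rw [← he] at h3 ⊢
      exact h3
    · obtain ⟨c, hc⟩ : ∃ c, E = c + i + 1 := ⟨E - i - 1, by omega⟩
      calc spow s E * spow s E = spow s c * (spow s i * spow s E) := by
            rw [← mul_assoc, spow_mul s c i, ← hc]
        _ = spow s E := by rw [h3, spow_mul, ← hc]
  rcases Nat.lt_or_gt_of_ne hij with hl | hl
  · exact key i j hl h
  · exact key j i hl h.symm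

theorem coreL [Finite S] (y u b : S) (h : y = u * y * b) :
    ∃ f w, f * f = f ∧ f * y = y ∧ f = u * w ∧ f = w * u := by
  obtain ⟨n, hn⟩ := exists_spow_idem u
  have hk : ∀ k, y = spow u k * y * spow b k := by
    intro k
    induction k with
    | zero => exact h
    | succ k ih =>
      have hb : spow b (k + 1) = b * spow b k := by
        have := spow_mul b 0 k
        rw [show k + 1 = 0 + k + 1 by omega, ← this]
        rfl
      rw [hb]
      change y = spow u k * u * y * (b * spow b k)
      calc y = spow u k * (u * y * b) * spow b k := by rw [← h]; exact ih
        _ = _ := by simp only [mul_assoc]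
  refine ⟨spow u n, spow u (n + n), hn, ?_, ?_, ?_⟩
  · have := hk n
    calc spow u n * y = (spow u n * spow u n) * y * spow b n := by
          conv_lhs => rw [this]
          simp only [mul_assoc]
      _ = y := by rw [hn, ← this]
  · have := spow_mul u 0 (n + n)
    rw [← hn, spow_mul]
    rw [show n + n + 1 = 0 + (n + n) + 1 by omega, ← this]
    rfl
  · rw [← hn, spow_mul]; rfl

theorem coreR [Finite S] (y a k : S) (h : y = a * y * k) :
    ∃ f w, f * f = f ∧ y * f = y ∧ f = k * w ∧ f = w * k := by
  have : Finite Sᵐᵒᵖ := Finite.of_equiv S MulOpposite.opEquiv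
  obtain ⟨f, w, h1, h2, h3, h4⟩ := coreL (S := Sᵐᵒᵖ) (MulOpposite.op y) (MulOpposite.op k)
    (MulOpposite.op a) (by
      rw [← MulOpposite.op_mul, ← MulOpposite.op_mul, ← mul_assoc, ← h])
  refine ⟨f.unop, w.unop, ?_, ?_, ?_, ?_⟩
  · rw [← MulOpposite.unop_mul, h1]
  · simpa using congrArg MulOpposite.unop h2
  · simpa using congrArg MulOpposite.unop h4
  · simpa using congrArg MulOpposite.unop h3

/-- The semigroup form of being syntactic for an irreducible shift:
`N` is the (possibly empty) set of images of non-factors. -/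
def IsNull (N : Set S) : Prop :=
  (∀ n ∈ N, ∀ s, s * n ∈ N ∧ n * s ∈ N) ∧ (∃ s, s ∉ N) ∧
  (∀ s t, s ∉ N → t ∉ N → ∃ r, s * r * t ∉ N) ∧
  (∀ s t, (∀ p q, p * s * q ∈ N ↔ p * t * q ∈ N) → s = t)

theorem stabL [Finite S] {N I : Set S} (hN : ∀ n ∈ N, ∀ s, s * n ∈ N ∧ n * s ∈ N)
    (hI : IsIdealSet I)
    (hA : ∀ p ∈ I, p ∉ N → ∀ y ∈ I, ∃ a b, y = a * p * b) (y p : S) (hy : y ∈ I)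
    (h : p * y ∉ N) : ∃ v, y = v * (p * y) := by
  obtain ⟨a, b, hab⟩ := hA (p * y) (hI.2 y hy p).1 h y hy
  obtain ⟨f, w, -, h2, -, h4⟩ := coreL y (a * p) b (by simpa only [mul_assoc] using hab)
  exact ⟨w * a, by conv_lhs => rw [← h2, h4]
                   simp only [mul_assoc]⟩

theorem stabR [Finite S] {N I : Set S} (hN : ∀ n ∈ N, ∀ s, s * n ∈ N ∧ n * s ∈ N)
    (hI : IsIdealSet I)
    (hA : ∀ p ∈ I, p ∉ N → ∀ y ∈ I, ∃ a b, y = a * p * b) (y p : S) (hy : y ∈ I)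
    (h : y * p ∉ N) : ∃ v, y = y * p * v := by
  obtain ⟨a, b, hab⟩ := hA (y * p) (hI.2 y hy p).2 h y hy
  obtain ⟨f, w, -, h2, h3, -⟩ := coreR y a (p * b) (by simpa only [mul_assoc] using hab)
  exact ⟨b * w, by conv_lhs => rw [← h2, h3]
                   simp only [mul_assoc]⟩

theorem aper_elem [Finite S] {I : Set S} (hI : IsIdealSet I) (hap : IsAperiodicSet I)
    (f T c : S) (hT : T ∈ I) (hf : f * f = f) (hfT : f * T = T) (hTf : T * f = T)
    (hc : c * T = f) : T = f := by
  obtain ⟨n, hn⟩ := exists_spow_idem T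
  have hu : ∀ k, ∃ u, u * spow T k = f := by
    intro k
    induction k with
    | zero => exact ⟨c, hc⟩
    | succ k ih =>
      obtain ⟨u, hu⟩ := ih
      refine ⟨c * u, ?_⟩
      change c * u * (spow T k * T) = f
      rw [mul_assoc, ← mul_assoc u, hu, hfT, hc]
  have hfk : ∀ k, f * spow T k = spow T k := by
    intro k
    induction k with
    | zero => exact hfT
    | succ k ih => change f * (spow T k * T) = spow T k * T; rw [← mul_assoc, ih]
  have hkf : ∀ k, spow T k * f = spow T k := by
    intro k
    cases k with
    | zero => exact hTf
    | succ k => change (spow T k * T) * f = spow T k * T; rw [mul_assoc, hTf]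
  have hfn : spow T n = f := by
    obtain ⟨u, hu⟩ := hu n
    calc spow T n = f * spow T n := (hfk n).symm
      _ = u * (spow T n * spow T n) := by rw [← hu, mul_assoc]
      _ = f := by rw [hn, hu]
  have hm : ∀ m, spow T (n * (m + 1) + m) = f := by
    intro m
    induction m with
    | zero => simpa using hfn
    | succ m ih =>
      have : n * (m + 1 + 1) + (m + 1) = (n * (m + 1) + m) + n + 1 := by ring
      rw [this, ← spow_mul, ih, hfn, hf]
  have hmem : ∀ k, spow T k ∈ I := by
    intro k
    cases k with
    | zero => exact hT
    | succ k => exact (hI.2 T hT _).1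
  refine hap (Set.range (spow T)) ?_ ?_ T ⟨0, rfl⟩ f ⟨n, hfn⟩
  · rintro _ ⟨k, rfl⟩; exact hmem k
  · refine ⟨⟨_, 0, rfl⟩, ?_, f, ⟨n, hfn⟩, ?_, ?_⟩
    · rintro _ ⟨i, rfl⟩ _ ⟨j, rfl⟩
      exact ⟨_, (spow_mul T i j).symm⟩
    · rintro _ ⟨i, rfl⟩
      exact ⟨hfk i, hkf i⟩
    · rintro _ ⟨i, rfl⟩
      have := hm (i + 1)
      refine ⟨_, ⟨n * (i + 1 + 1), rfl⟩, ?_, ?_⟩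
      · rw [spow_mul, ← this]; congr 1; ring
      · rw [spow_mul, ← this]; congr 1

theorem final_eq [Finite S] {N I : Set S} (hN : ∀ n ∈ N, ∀ s, s * n ∈ N ∧ n * s ∈ N)
    (hI : IsIdealSet I)
    (hP : ∀ s t, s ∉ N → t ∉ N → ∃ r, s * r * t ∉ N)
    (hA : ∀ p ∈ I, p ∉ N → ∀ y ∈ I, ∃ a b, y = a * p * b) (hap : IsAperiodicSet I)
    (y x s t : S) (hy : y ∈ I) (hx : x ∈ I) (hs : y * s * x ∉ N) (ht : y * t * x ∉ N) :
    y * s * x = y * t * x := by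
  obtain ⟨v1, hv1⟩ := stabR hN hI hA y (s * x) hy (by rwa [← mul_assoc])
  obtain ⟨v2, hv2⟩ := stabL hN hI hA x (y * s) hx hs
  obtain ⟨v3, hv3⟩ := stabL hN hI hA x (y * t) hx ht
  have hpI : y * s * x ∈ I := (hI.2 x hx _).1
  have hqI : y * t * x ∈ I := (hI.2 x hx _).1
  obtain ⟨d, hd⟩ : ∃ d, y * t * x = y * s * x * d :=
    ⟨v1 * t * x, by conv_lhs => rw [hv1]
                    simp only [mul_assoc]⟩
  obtain ⟨g, hg⟩ : ∃ g, y * t * x = g * (y * s * x) :=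
    ⟨y * t * v2, by conv_lhs => rw [hv2]
                    simp only [mul_assoc]⟩
  obtain ⟨c, hc⟩ : ∃ c, y * s * x = c * (y * t * x) :=
    ⟨y * s * v3, by conv_lhs => rw [hv3]
                    simp only [mul_assoc]⟩
  generalize y * s * x = p at *
  generalize y * t * x = q at *
  obtain ⟨r, hr⟩ := hP p p hs hs
  obtain ⟨v, hv⟩ := stabR hN hI hA p (r * p) hpI (by rwa [← mul_assoc])
  obtain ⟨f, w, hff, hfp, hfw, -⟩ := coreL p (p * r) v (by simpa only [mul_assoc] using hv)
  have hph : p * (r * w * f) = f := by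
    rw [← mul_assoc, ← mul_assoc, ← hfw, hff]
  have hTf : q * (r * w * f) * f = q * (r * w * f) := by
    simp only [mul_assoc, hff]
  generalize r * w * f = h at *
  have hT : q * h = f := by
    refine aper_elem hI hap f (q * h) c (hI.2 q hqI h).2 hff ?_ hTf ?_
    · rw [← mul_assoc, hd, ← mul_assoc f, hfp]
    · rw [← mul_assoc, ← hc, hph]
  calc p = f * p := hfp.symm
    _ = g * (p * h) * p := by rw [← hT, hg]; simp only [mul_assoc]
    _ = q := by rw [hph, mul_assoc, hfp, hg]

/-- The set `S p S` is an ideal. -/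
theorem ideal_SpS (p : S) : IsIdealSet {y : S | ∃ a b, y = a * p * b} := by
  refine ⟨⟨p * p * p, p, p, rfl⟩, ?_⟩
  rintro _ ⟨a, b, rfl⟩ s
  exact ⟨⟨s * a, b, by simp only [mul_assoc]⟩, ⟨a, b * s, by simp only [mul_assoc]⟩⟩

theorem SpS_subset {I : Set S} (hI : IsIdealSet I) {p : S} (hp : p ∈ I) :
    {y : S | ∃ a b, y = a * p * b} ⊆ I := by
  rintro _ ⟨a, b, rfl⟩
  exact (hI.2 _ (hI.2 p hp a).1 b).2

theorem hA_of_zeroMin {z : S} (hz : IsZeroElem z) {I : Set S} (hI : IsZeroMinIdeal z I)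
    (hP : ∀ s t : S, s ∉ ({z} : Set S) → t ∉ ({z} : Set S) → ∃ r, s * r * t ∉ ({z} : Set S)) :
    ∀ p ∈ I, p ∉ ({z} : Set S) → ∀ y ∈ I, ∃ a b, y = a * p * b := by
  intro p hp hpz y hy
  rcases hI.2.2 _ (ideal_SpS p) (SpS_subset hI.1 hp) with h | h
  · exfalso
    obtain ⟨r, hr⟩ := hP p p hpz hpz
    obtain ⟨r', hr'⟩ := hP _ p hr hpz
    apply hr'
    rw [← h]
    exact ⟨p * r, r' * p, by simp only [mul_assoc]⟩
  · rw [← h] at hy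
    exact hy

theorem null_of_AGGM [Finite S] [Nonempty S] (h : IsAGGM S) : ∃ N : Set S, IsNull N := by
  obtain ⟨I, hI, hL, hR, hap⟩ := h
  rcases hI with hI | ⟨z, hz, hI⟩
  · refine ⟨∅, by simp, ⟨Classical.arbitrary S, by simp⟩, ?_, ?_⟩
    · intro s t _ _; exact ⟨s, by simp⟩
    · intro s t _
      apply hL
      intro x hx
      apply hR
      intro y hy
      rw [← mul_assoc, ← mul_assoc]
      refine final_eq (N := ∅) (by simp) hI.1 (fun s t _ _ => ⟨s, by simp⟩) ?_ hap y x s t hy hx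
        (by simp) (by simp)
      intro p hp _ y hy
      have := hI.2 _ (ideal_SpS p) (SpS_subset hI.1 hp)
      rw [← this] at hy
      exact hy
  · have hzI : z ∈ I := by
      obtain ⟨a, ha⟩ := hI.1.1
      have := (hI.1.2 a ha z).1
      rwa [(hz a).1] at this
    -- nonzero elements act nontrivially
    have hL' : ∀ s, s ≠ z → ∃ a ∈ I, s * a ≠ z := by
      intro s hs
      by_contra hcon
      push Not at hcon
      exact hs (hL s z fun a ha => by rw [hcon a ha, (hz a).1])
    have hR' : ∀ s, s ≠ z → ∃ a ∈ I, a * s ≠ z := by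
      intro s hs
      by_contra hcon
      push Not at hcon
      exact hs (hR s z fun a ha => by rw [hcon a ha, (hz a).2])
    have hP0 : ∀ x ∈ I, ∀ y ∈ I, x ≠ z → y ≠ z → ∃ r, x * r * y ≠ z := by
      intro x hx y hy hxz hyz
      by_contra hcon
      push Not at hcon
      have hK : IsIdealSet {k : S | k ∈ I ∧ ∀ r, k * r * y = z} := by
        refine ⟨⟨x, hx, hcon⟩, ?_⟩
        rintro k ⟨hk, hk'⟩ s
        refine ⟨⟨(hI.1.2 k hk s).1, fun r => ?_⟩, ⟨(hI.1.2 k hk s).2, fun r => ?_⟩⟩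
        · rw [mul_assoc, mul_assoc, ← mul_assoc k, hk', (hz s).2]
        · rw [mul_assoc k, hk']
      rcases hI.2.2 _ hK (fun k hk => hk.1) with h | h
      · have : x ∈ ({z} : Set S) := by rw [← h]; exact ⟨hx, hcon⟩
        exact hxz this
      · obtain ⟨a, ha, hay⟩ := hR' y hyz
        obtain ⟨b, hb, hbay⟩ := hR' _ hay
        rw [← h] at hb
        exact hbay (by rw [← mul_assoc]; exact hb.2 a)
    have hP : ∀ s t : S, s ∉ ({z} : Set S) → t ∉ ({z} : Set S) →
        ∃ r, s * r * t ∉ ({z} : Set S) := by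
      intro s t hs ht
      obtain ⟨a, ha, hsa⟩ := hL' s hs
      obtain ⟨b, hb, hbt⟩ := hR' t ht
      obtain ⟨r, hr⟩ := hP0 _ (hI.1.2 a ha s).1 _ (hI.1.2 b hb t).2 hsa hbt
      exact ⟨a * r * b, by simpa only [mul_assoc, Set.mem_singleton_iff] using hr⟩
    have hN : ∀ n ∈ ({z} : Set S), ∀ s, s * n ∈ ({z} : Set S) ∧ n * s ∈ ({z} : Set S) := by
      rintro _ rfl s
      exact ⟨(hz s).2, (hz s).1⟩
    have hA := hA_of_zeroMin hz hI hP
    refine ⟨{z}, hN, ?_, hP, ?_⟩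
    · by_contra hcon
      push Not at hcon
      apply hI.2.1
      ext a
      exact ⟨fun _ => hcon a, fun h => by rw [Set.mem_singleton_iff.1 h]; exact hzI⟩
    · intro s t hst
      apply hL
      intro x hx
      apply hR
      intro y hy
      rw [← mul_assoc, ← mul_assoc]
      by_cases h1 : y * s * x ∈ ({z} : Set S)
      · have h2 := (hst y x).1 h1
        rw [Set.mem_singleton_iff.1 h1, Set.mem_singleton_iff.1 h2]
      · exact final_eq hN hI.1 hP hA hap y x s t hy hx h1 (fun h2 => h1 ((hst y x).2 h2))

theorem exists_zeroMin [Finite S] {z : S} (hz : IsZeroElem z) (hne : ∃ s : S, s ≠ z) :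
    ∃ I, IsZeroMinIdeal z I := by
  have hfin : {J : Set S | IsIdealSet J ∧ J ≠ {z}}.Finite := Set.toFinite _
  have hn : {J : Set S | IsIdealSet J ∧ J ≠ {z}}.Nonempty := by
    refine ⟨Set.univ, ⟨⟨z, trivial⟩, fun _ _ _ => ⟨trivial, trivial⟩⟩, ?_⟩
    obtain ⟨s, hs⟩ := hne
    intro h
    have : s ∈ ({z} : Set S) := by rw [← h]; trivial
    exact hs this
  obtain ⟨I, hI⟩ := hfin.exists_minimal hn
  refine ⟨I, hI.1.1, hI.1.2, ?_⟩
  intro J hJ hJI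
  by_cases h : J = {z}
  · exact Or.inl h
  · exact Or.inr (Set.Subset.antisymm hJI (hI.2 (show J ∈ _ from ⟨hJ, h⟩) hJI))

theorem AGGM_of_null [Finite S] {N : Set S} (h : IsNull N) : IsAGGM S := by
  obtain ⟨hN, ⟨s0, hs0⟩, hP, hF⟩ := h
  by_cases hemp : ∃ z, z ∈ N
  · obtain ⟨z, hzN⟩ := hemp
    have huniq : ∀ n ∈ N, n = z := by
      intro n hn
      apply hF
      intro p q
      exact ⟨fun _ => (hN _ (hN _ hzN p).1 q).2, fun _ => (hN _ (hN _ hn p).1 q).2⟩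
    obtain rfl : N = {z} := by
      ext a
      exact ⟨huniq a, fun h => by rw [Set.mem_singleton_iff.1 h]; exact hzN⟩
    have hz : IsZeroElem z := fun s => ⟨(hN z rfl s).2, (hN z rfl s).1⟩
    obtain ⟨I, hI⟩ := exists_zeroMin hz ⟨s0, hs0⟩
    have hA := hA_of_zeroMin hz hI hP
    have hzI : z ∈ I := by
      obtain ⟨a, ha⟩ := hI.1.1
      have := (hI.1.2 a ha z).1
      rwa [(hz a).1] at this
    obtain ⟨a, haI, haz⟩ : ∃ a ∈ I, a ≠ z := by
      by_contra hcon
      push Not at hcon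
      apply hI.2.1
      ext a
      exact ⟨fun h => hcon a h, fun h => by rw [Set.mem_singleton_iff.1 h]; exact hzI⟩
    have hLL : ∀ s t : S, (∀ a ∈ I, s * a = t * a) → ∀ p q, p * s * q = z → p * t * q = z := by
      intro s t hst p q hpq
      by_contra hcon
      obtain ⟨r, hr⟩ := hP _ a hcon haz
      apply hr
      have h1 : t * (q * r * a) = s * (q * r * a) := (hst _ (hI.1.2 a haI _).1).symm
      calc p * t * q * r * a = p * (t * (q * r * a)) := by simp only [mul_assoc]
        _ = p * s * q * (r * a) := by rw [h1]; simp only [mul_assoc]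
        _ = z := by rw [hpq, (hz _).1]
    have hRR : ∀ s t : S, (∀ a ∈ I, a * s = a * t) → ∀ p q, p * s * q = z → p * t * q = z := by
      intro s t hst p q hpq
      by_contra hcon
      obtain ⟨r, hr⟩ := hP a _ haz hcon
      apply hr
      have h1 : (a * r * p) * t = (a * r * p) * s := by
        refine (hst _ ?_).symm
        rw [mul_assoc]; exact (hI.1.2 a haI _).2
      calc a * r * (p * t * q) = (a * r * p) * t * q := by simp only [mul_assoc]
        _ = a * r * (p * s * q) := by rw [h1]; simp only [mul_assoc]
        _ = z := by rw [hpq, (hz _).2]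
    refine ⟨I, Or.inr ⟨z, hz, hI⟩, ?_, ?_, ?_⟩
    · intro s t hst
      apply hF
      intro p q
      exact ⟨hLL s t hst p q, hLL t s (fun a ha => (hst a ha).symm) p q⟩
    · intro s t hst
      apply hF
      intro p q
      exact ⟨hRR s t hst p q, hRR t s (fun a ha => (hst a ha).symm) p q⟩
    · rintro G hGI ⟨-, hmul, e, heG, hid, hinv⟩
      have hx : ∀ g ∈ G, ∀ g' ∈ G, ∀ p q, p * g * q = z → p * g' * q = z := by
        intro g hg g' hg' p q hpq
        by_contra hcon
        obtain ⟨k, hk, hgk, hkg⟩ := hinv g hg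
        -- g' = g * m
        have hpg' : p * g' ≠ z := fun h => hcon (by rw [h, (hz _).1])
        obtain ⟨v, hv⟩ := stabL hN hI.1 hA g' p (hGI hg') hpg'
        obtain ⟨k', hk', hgk', hkg'⟩ := hinv g' hg'
        have hpg : v * p * g = g := by
          calc v * p * g = v * (p * (g' * k' * g)) := by
                rw [hgk', (hid g hg).1, mul_assoc]
            _ = v * (p * g') * (k' * g) := by simp only [mul_assoc]
            _ = g := by rw [← hv, ← mul_assoc, hgk', (hid g hg).1]
        have hgq : g * q = z := by
          calc g * q = v * (p * g * q) := by
                conv_lhs => rw [← hpg]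
                simp only [mul_assoc]
            _ = z := by rw [hpq, (hz _).2]
        apply hcon
        calc p * g' * q = p * (g' * k * (g * q)) := by
              rw [mul_assoc g', ← mul_assoc k, hkg, ← mul_assoc g', (hid g' hg').2, mul_assoc]
          _ = z := by rw [hgq, (hz _).2, (hz _).2]
      intro g hg g' hg'
      apply hF
      intro p q
      exact ⟨hx g hg g' hg' p q, hx g' hg' g hg p q⟩
  · have hsub : ∀ s t : S, s = t := by
      intro s t
      apply hF
      intro p q
      exact ⟨fun h => (hemp ⟨_, h⟩).elim, fun h => (hemp ⟨_, h⟩).elim⟩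
    refine ⟨Set.univ, Or.inl ⟨⟨⟨s0, trivial⟩, fun _ _ _ => ⟨trivial, trivial⟩⟩, ?_⟩,
      fun s t _ => hsub s t, fun s t _ => hsub s t, fun _ _ _ a _ b _ => hsub a b⟩
    rintro J ⟨⟨j, hj⟩, -⟩ -
    ext a
    exact ⟨fun _ => trivial, fun _ => by rw [hsub a j]; exact hj⟩

/-- A recurrent loop through `s`. -/
theorem exists_loop [Finite S] {N : Set S}
    (hP : ∀ s t, s ∉ N → t ∉ N → ∃ r, s * r * t ∉ N) (s : S) (hs : s ∉ N) :
    ∃ t h, t ∉ N ∧ t = t * (h * s) := by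
  classical
  choose! r hr using fun t ht => hP t s ht hs
  let F : S → S := fun t => t * r t * s
  have hFN : ∀ n t, t ∉ N → F^[n] t ∉ N := by
    intro n
    induction n with
    | zero => intro t ht; exact ht
    | succ n ih => intro t ht; exact ih _ (hr t ht)
  have hFh : ∀ n t, ∃ h, F^[n + 1] t = t * (h * s) := by
    intro n
    induction n with
    | zero => intro t; exact ⟨r t, by simp only [zero_add, Function.iterate_one, F, mul_assoc]⟩
    | succ n ih =>
      intro t
      obtain ⟨h, hh⟩ := ih t
      refine ⟨h * s * r (F^[n + 1] t), ?_⟩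
      rw [Function.iterate_succ_apply']
      change F^[n + 1] t * r (F^[n + 1] t) * s = _
      conv_lhs => rw [hh]
      rw [hh]
      simp only [mul_assoc]
  have key : ∀ i j : ℕ, i < j → F^[i] s = F^[j] s → ∃ t h, t ∉ N ∧ t = t * (h * s) := by
    intro i j hlt hij
    obtain ⟨d, rfl⟩ : ∃ d, j = (d + 1) + i := ⟨j - i - 1, by omega⟩
    obtain ⟨h, hh⟩ := hFh d (F^[i] s)
    refine ⟨F^[i] s, h, hFN i s hs, ?_⟩
    rw [← hh, ← Function.iterate_add_apply]
    exact hij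
  obtain ⟨i, j, hne, hij⟩ := Finite.exists_ne_map_eq_of_infinite (fun n => F^[n] s)
  rcases Nat.lt_or_gt_of_ne hne with hl | hl
  · exact key i j hl hij
  · exact key j i hl hij.symm

end SemigroupPart

section WordPart

variable {X : Type*}

theorem wordAt_eq (x : ℤ → X) (i : ℤ) (n : ℕ) :
    wordAt x i n = (List.range n).map (fun k : ℕ => x (i + (k : ℤ))) := by
  have h : ∀ l : List ℕ, (do let a ← l; pure (a : ℤ) : List ℤ) = l.map (fun k : ℕ => (k : ℤ)) := by
    intro l
    induction l with
    | nil => rfl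
    | cons a l ih => simpa using ih
  unfold wordAt
  rw [h, List.map_map]
  rfl

@[simp] theorem length_wordAt (x : ℤ → X) (i : ℤ) (n : ℕ) : (wordAt x i n).length = n := by
  simp [wordAt_eq]

theorem wordAt_add (x : ℤ → X) (i : ℤ) (m n : ℕ) :
    wordAt x i (m + n) = wordAt x i m ++ wordAt x (i + m) n := by
  simp only [wordAt_eq, List.range_add, List.map_append, List.map_map]
  congr 1
  apply List.map_congr_left
  intro k _
  simp only [Function.comp, Nat.cast_add, add_assoc]

theorem wordAt_ne_nil (x : ℤ → X) (i : ℤ) (n : ℕ) (hn : n ≠ 0) : wordAt x i n ≠ [] := by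
  intro h
  have := congrArg List.length h
  simp at this
  exact hn this

theorem lang_factor {𝒳 : Set (ℤ → X)} {a u b : List X} (hu : u ≠ [])
    (h : a ++ u ++ b ∈ shiftLang 𝒳) : u ∈ shiftLang 𝒳 := by
  obtain ⟨-, x, hx, i, hw⟩ := h
  refine ⟨hu, x, hx, i + a.length, ?_⟩
  rw [List.length_append, List.length_append, wordAt_add, wordAt_add] at hw
  have h1 := (List.append_inj hw (by simp)).1
  exact (List.append_inj h1 (by simp)).2

/-- the periodic point attached to a non-empty word -/
def perPt (g : List X) (hg : 0 < g.length) : ℤ → X := fun i =>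
  g[(i % (g.length : ℤ)).toNat]'(by
    have h1 := Int.emod_nonneg i (b := (g.length : ℤ)) (by omega)
    have h2 := Int.emod_lt_of_pos i (b := (g.length : ℤ)) (by omega)
    omega)

theorem perPt_add (g : List X) (hg : 0 < g.length) (i k : ℤ) :
    perPt g hg (i + k * g.length) = perPt g hg i := by
  simp [perPt]

theorem wordAt_perPt_add (g : List X) (hg : 0 < g.length) (i k : ℤ) (n : ℕ) :
    wordAt (perPt g hg) (i + k * g.length) n = wordAt (perPt g hg) i n := by
  apply List.map_congr_left
  intro j _
  rw [show i + k * g.length + j = (i + j) + k * g.length by ring, perPt_add]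

theorem wordAt_perPt_zero (g : List X) (hg : 0 < g.length) :
    wordAt (perPt g hg) 0 g.length = g := by
  apply List.ext_getElem
  · simp
  · intro n h1 h2
    have h3 : ((n : ℤ) % (g.length : ℤ)).toNat = n := by
      rw [Int.emod_eq_of_lt (by omega) (by omega)]; simp
    simp [wordAt_eq, perPt, h3]

theorem wordAt_perPt_factor (g : List X) (hg : 0 < g.length) (i : ℤ) (n : ℕ) :
    ∃ m a b, wordAt (perPt g hg) 0 ((m + 1) * g.length) = a ++ wordAt (perPt g hg) i n ++ b := by
  have h1 := Int.emod_nonneg i (b := (g.length : ℤ)) (by omega)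
  have hi : i = i % (g.length : ℤ) + (i / (g.length : ℤ)) * g.length := by
    rw [mul_comm]; exact (Int.emod_add_mul_ediv i _).symm
  obtain ⟨j, hj⟩ : ∃ j : ℕ, i % (g.length : ℤ) = j := ⟨_, (Int.toNat_of_nonneg h1).symm⟩
  rw [hi, wordAt_perPt_add, hj]
  obtain ⟨c, hc⟩ : ∃ c, (j + n + 1) * g.length = (j + n) + c :=
    ⟨(j + n + 1) * g.length - (j + n), by
      have : (j + n + 1) * 1 ≤ (j + n + 1) * g.length := Nat.mul_le_mul_left _ hg
      omega⟩
  refine ⟨j + n, wordAt (perPt g hg) 0 j, wordAt (perPt g hg) (0 + ((j + n : ℕ) : ℤ)) c, ?_⟩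
  rw [hc, wordAt_add, wordAt_add]
  simp

theorem isClosed_word [TopologicalSpace X] [DiscreteTopology X] (i : ℤ) (n : ℕ)
    (A : Set (List X)) : IsClosed {x : ℤ → X | wordAt x i n ∈ A} := by
  have hc : Continuous (fun (x : ℤ → X) (k : Fin n) => x (i + (k : ℕ))) := by fun_prop
  have := (isClosed_discrete {v : Fin n → X | List.ofFn v ∈ A}).preimage hc
  convert this using 1
  ext x
  simp only [Set.mem_ofPred_eq, Set.mem_preimage]
  have : wordAt x i n = List.ofFn (fun k : Fin n => x (i + (k : ℕ))) := by
    apply List.ext_getElem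
    · simp
    · intro k h1 h2; simp [wordAt_eq]
  rw [this]

variable {S : Type*} [Semigroup S] (π : List X → S)

theorem null_of_shift (hπ : ∀ u v : List X, u ≠ [] → v ≠ [] → π (u ++ v) = π u * π v)
    (hsurj : ∀ s : S, ∃ w : List X, w ≠ [] ∧ π w = s)
    (𝒳 : Set (ℤ → X)) (hne : 𝒳.Nonempty) (hirr : IsIrreducibleLang (shiftLang 𝒳))
    (hsyn : ∀ u v : List X, u ≠ [] → v ≠ [] →
        (π u = π v ↔ ∀ a b : List X,
          (a ++ u ++ b ∈ shiftLang 𝒳 ↔ a ++ v ++ b ∈ shiftLang 𝒳))) :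
    ∃ N : Set S, IsNull N := by
  let N : Set S := {s | ∃ w, w ≠ [] ∧ π w = s ∧ w ∉ shiftLang 𝒳}
  have hmem : ∀ w, w ≠ [] → (π w ∉ N ↔ w ∈ shiftLang 𝒳) := by
    intro w hw
    constructor
    · intro h
      by_contra hc
      exact h ⟨w, hw, rfl, hc⟩
    · rintro h ⟨w', hw', he, hn⟩
      apply hn
      have := (hsyn w' w hw' hw).1 he [] []
      simpa using this.2 (by simpa using h)
  refine ⟨N, ?_, ?_, ?_, ?_⟩
  · rintro _ ⟨w, hw, rfl, hn⟩ s
    obtain ⟨v, hv, rfl⟩ := hsurj s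
    constructor
    · refine ⟨v ++ w, by simp [hw], hπ _ _ hv hw, fun h => hn ?_⟩
      exact lang_factor (a := v) (b := []) hw (by simpa using h)
    · refine ⟨w ++ v, by simp [hw], hπ _ _ hw hv, fun h => hn ?_⟩
      exact lang_factor (a := []) (b := v) hw (by simpa using h)
  · obtain ⟨x, hx⟩ := hne
    refine ⟨π (wordAt x 0 1), ?_⟩
    rw [hmem _ (wordAt_ne_nil _ _ _ one_ne_zero)]
    exact ⟨wordAt_ne_nil _ _ _ one_ne_zero, x, hx, 0, by simp⟩
  · intro s t hs ht
    obtain ⟨u, hu, rfl⟩ := hsurj s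
    obtain ⟨v, hv, rfl⟩ := hsurj t
    rw [hmem _ hu] at hs
    rw [hmem _ hv] at ht
    obtain ⟨w, hw⟩ := hirr u hs v ht
    obtain ⟨w', hw'⟩ := hirr _ hw _ hw
    have hr : w ++ v ++ w' ++ u ++ w ≠ [] := by simp [hv]
    refine ⟨π (w ++ v ++ w' ++ u ++ w), ?_⟩
    rw [← hπ _ _ hu hr, ← hπ _ _ (by simp [hu]) hv, hmem _ (by simp [hu])]
    simpa only [List.append_assoc] using hw'
  · intro s t hst
    have key : ∀ u v a b : List X, u ≠ [] → v ≠ [] →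
        (∀ p q, p * π u * q ∈ N ↔ p * π v * q ∈ N) →
        a ++ u ++ b ∈ shiftLang 𝒳 → a ++ v ++ b ∈ shiftLang 𝒳 := by
      intro u v a b hu hv hst h
      obtain ⟨r, hr⟩ := hirr _ h _ h
      obtain ⟨r', hr'⟩ := hirr _ hr _ h
      have hm : a ++ u ++ b ≠ [] := h.1
      generalize hmm : a ++ u ++ b = m at *
      have h1 : m ++ r ++ a ≠ [] := by simp [hm]
      have h2 : b ++ r' ++ m ≠ [] := by simp [hm]
      have e : ∀ w, w ≠ [] → π (m ++ r ++ a) * π w * π (b ++ r' ++ m)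
          = π (m ++ r ++ a ++ w ++ (b ++ r' ++ m)) := by
        intro w hw
        rw [hπ _ _ (by simp [hw]) h2, hπ _ _ h1 hw]
      have h3 := not_congr (hst (π (m ++ r ++ a)) (π (b ++ r' ++ m)))
      rw [e u hu, e v hv, hmem _ (by simp [hu]), hmem _ (by simp [hv])] at h3
      have h4 := h3.1 (by
        have : m ++ r ++ m ++ r' ++ m ∈ shiftLang 𝒳 := hr'
        have e2 : m ++ r ++ m ++ r' ++ m = m ++ r ++ a ++ u ++ (b ++ r' ++ m) := by
          conv_lhs => rw [show m ++ r ++ m ++ r' ++ m = m ++ r ++ (a ++ u ++ b) ++ r' ++ m by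
            rw [hmm]]
          simp only [List.append_assoc]
        rwa [e2] at this)
      refine lang_factor (a := m ++ r) (b := r' ++ m) (by simp [hv]) ?_
      simpa only [List.append_assoc] using h4
    obtain ⟨u, hu, rfl⟩ := hsurj s
    obtain ⟨v, hv, rfl⟩ := hsurj t
    rw [hsyn u v hu hv]
    intro a b
    exact ⟨key u v a b hu hv hst, key v u a b hv hu (fun p q => (hst p q).symm)⟩

theorem pi_factor_notin (hπ : ∀ u v : List X, u ≠ [] → v ≠ [] → π (u ++ v) = π u * π v)
    {N : Set S} (hN : ∀ n ∈ N, ∀ s, s * n ∈ N ∧ n * s ∈ N) {a u b : List X} (hu : u ≠ [])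
    (h : π (a ++ u ++ b) ∉ N) : π u ∉ N := by
  intro hc
  apply h
  have h1 : π (a ++ u) ∈ N := by
    by_cases ha : a = []
    · simpa [ha] using hc
    · rw [hπ a u ha hu]; exact (hN _ hc _).1
  by_cases hb : b = []
  · simpa [hb] using h1
  · rw [hπ _ b (by simp [hu]) hb]; exact (hN _ h1 _).2

theorem regular_of_null [Finite S]
    (hπ : ∀ u v : List X, u ≠ [] → v ≠ [] → π (u ++ v) = π u * π v) (N : Set S) :
    Language.IsRegular ({w | w ≠ [] ∧ π w ∉ N} : Set (List X)) := by
  classical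
  have := Fintype.ofFinite S
  let M : DFA X (Option S) :=
    { step := fun o a => match o with
        | none => some (π [a])
        | some s => some (s * π [a])
      start := none
      accept := {o | ∃ s, s ∉ N ∧ o = some s} }
  have hM : ∀ w : List X, w ≠ [] → M.eval w = some (π w) := by
    intro w
    induction w using List.reverseRecOn with
    | nil => intro h; exact (h rfl).elim
    | append_singleton w a ih =>
      intro _
      rw [DFA.eval_append_singleton]
      by_cases hw : w = []
      · subst hw; rfl
      · rw [ih hw, hπ w [a] hw (by simp)]
  refine Language.isRegular_iff.2 ⟨Option S, inferInstance, M, ?_⟩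
  refine Set.ext fun w => ?_
  change M.eval w ∈ M.accept ↔ _
  by_cases hw : w = []
  · subst hw
    constructor
    · rintro ⟨s, -, hs⟩; cases hs
    · rintro ⟨h, -⟩; exact (h rfl).elim
  · rw [hM w hw]
    constructor
    · rintro ⟨s, hs, he⟩
      cases he
      exact ⟨hw, hs⟩
    · rintro ⟨-, h⟩
      exact ⟨_, h, rfl⟩

theorem shift_of_null [TopologicalSpace X] [DiscreteTopology X] [Finite S]
    (hπ : ∀ u v : List X, u ≠ [] → v ≠ [] → π (u ++ v) = π u * π v)
    (hsurj : ∀ s : S, ∃ w : List X, w ≠ [] ∧ π w = s) {N : Set S} (h : IsNull N) :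
    ∃ 𝒳 : Set (ℤ → X), IsSubshift 𝒳 ∧ IsIrreducibleLang (shiftLang 𝒳) ∧
      Language.IsRegular (shiftLang 𝒳) ∧
      (∀ u v : List X, u ≠ [] → v ≠ [] →
        (π u = π v ↔ ∀ a b : List X,
          (a ++ u ++ b ∈ shiftLang 𝒳 ↔ a ++ v ++ b ∈ shiftLang 𝒳))) := by
  obtain ⟨hN, ⟨s0, hs0⟩, hP, hF⟩ := h
  let 𝒳 : Set (ℤ → X) := {x | ∀ (i : ℤ) (n : ℕ), wordAt x i (n + 1) ∈ {w | π w ∉ N}}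
  have hpt : ∀ w, w ≠ [] → π w ∉ N → w ∈ shiftLang 𝒳 := by
    intro w hw hwN
    obtain ⟨t, k, ht, hk⟩ := exists_loop hP (π w) hwN
    obtain ⟨v, hv, rfl⟩ := hsurj k
    have hg : 0 < (v ++ w).length := List.length_pos_iff.2 (by simp [hw])
    rw [← hπ v w hv hw] at hk
    have hpow : ∀ m : ℕ, t * π (wordAt (perPt (v ++ w) hg) 0 ((m + 1) * (v ++ w).length)) = t := by
      intro m
      induction m with
      | zero => rw [zero_add, one_mul, wordAt_perPt_zero]; exact hk.symm
      | succ m ih =>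
        rw [add_mul (m + 1), one_mul, wordAt_add]
        have h0 := wordAt_perPt_add (v ++ w) hg 0 ((m + 1 : ℕ) : ℤ) (v ++ w).length
        rw [Nat.cast_mul, h0, wordAt_perPt_zero, hπ _ _ (wordAt_ne_nil _ _ _ (by positivity))
          (by simp [hw]), ← mul_assoc, ih, ← hk]
    refine ⟨hw, perPt (v ++ w) hg, ?_, v.length, ?_⟩
    · intro i n
      obtain ⟨m, a, b, hab⟩ := wordAt_perPt_factor (v ++ w) hg i (n + 1)
      refine pi_factor_notin π hπ hN (a := a) (b := b) (wordAt_ne_nil _ _ _ (by omega)) ?_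
      rw [← hab]
      intro hc
      apply ht
      rw [← hpow m]
      exact (hN _ hc t).1
    · have h0 := wordAt_perPt_zero (v ++ w) hg
      rw [show wordAt (perPt (v ++ w) hg) 0 (v ++ w).length
        = wordAt (perPt (v ++ w) hg) 0 (v.length + w.length) by simp, wordAt_add] at h0
      have := (List.append_inj h0 (by simp)).2
      simpa using this.symm
  have hlang : shiftLang 𝒳 = {w | w ≠ [] ∧ π w ∉ N} := by
    ext w
    constructor
    · rintro ⟨hw, x, hx, i, he⟩
      refine ⟨hw, ?_⟩
      obtain ⟨n, hn⟩ : ∃ n, w.length = n + 1 :=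
        Nat.exists_eq_succ_of_ne_zero (by simpa using hw)
      rw [he, hn]
      exact hx i n
    · rintro ⟨hw, h⟩
      exact hpt w hw h
  have hsh : ∀ (x : ℤ → X) i n, wordAt (shiftMap X x) i n = wordAt x (i + 1) n := by
    intro x i n
    apply List.map_congr_left
    intro k _
    simp only [shiftMap]
    congr 1; ring
  refine ⟨𝒳, ⟨?_, ?_, ?_⟩, ?_, ?_, ?_⟩
  · obtain ⟨w, hw, rfl⟩ := hsurj s0
    obtain ⟨-, x, hx, -⟩ := hpt w hw hs0
    exact ⟨x, hx⟩
  · have : 𝒳 = ⋂ (i : ℤ) (n : ℕ), {x | wordAt x i (n + 1) ∈ {w | π w ∉ N}} := by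
      ext x; simp [𝒳]
    rw [this]
    exact isClosed_iInter fun i => isClosed_iInter fun n => isClosed_word i (n + 1) _
  · ext x
    constructor
    · rintro ⟨y, hy, rfl⟩ i n
      rw [hsh]; exact hy _ _
    · intro hx
      have hxy : shiftMap X (fun i => x (i - 1)) = x := by
        funext i; simp [shiftMap]
      refine ⟨fun i => x (i - 1), ?_, hxy⟩
      intro i n
      have := hsh (fun i => x (i - 1)) (i - 1) (n + 1)
      rw [hxy, sub_add_cancel] at this
      rw [← this]
      exact hx _ _
  · rw [hlang]
    rintro u ⟨hu, huN⟩ v ⟨hv, hvN⟩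
    obtain ⟨r, hr⟩ := hP _ _ huN hvN
    obtain ⟨w, hw, rfl⟩ := hsurj r
    refine ⟨w, by simp [hu], ?_⟩
    rwa [hπ _ _ (by simp [hu]) hv, hπ _ _ hu hw]
  · rw [hlang]
    exact regular_of_null π hπ N
  · rw [hlang]
    intro u v hu hv
    have ectx : ∀ a b : List X, π u = π v → π (a ++ u ++ b) = π (a ++ v ++ b) := by
      intro a b h
      have h1 : π (a ++ u) = π (a ++ v) := by
        by_cases ha : a = []
        · simpa [ha] using h
        · rw [hπ _ _ ha hu, hπ _ _ ha hv, h]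
      by_cases hb : b = []
      · simpa [hb] using h1
      · rw [hπ _ _ (by simp [hu]) hb, hπ _ _ (by simp [hv]) hb, h1]
    constructor
    · intro h a b
      simp only [Set.mem_ofPred_eq]
      rw [ectx a b h]
      simp [hu, hv]
    · intro h
      apply hF
      intro p q
      obtain ⟨a, ha, rfl⟩ := hsurj p
      obtain ⟨b, hb, rfl⟩ := hsurj q
      rw [← hπ _ _ ha hu, ← hπ _ _ ha hv, ← hπ _ _ (by simp [hu]) hb, ← hπ _ _ (by simp [hv]) hb]
      have h1 := h a b
      simp only [Set.mem_ofPred_eq] at h1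
      have e1 : a ++ u ++ b ≠ [] := by simp [hu]
      have e2 : a ++ v ++ b ≠ [] := by simp [hv]
      have h2 : π (a ++ u ++ b) ∉ N ↔ π (a ++ v ++ b) ∉ N :=
        ⟨fun k => (h1.1 ⟨e1, k⟩).2, fun k => (h1.2 ⟨e2, k⟩).2⟩
      exact not_iff_not.1 h2

end WordPart

/-- A finite `X`-generated semigroup `S` (via a surjective homomorphism
`π : X⁺ → S`) is the syntactic semigroup, via `π`, of the language of an
irreducible sofic shift over `X` if and only if `S` is an `AGGM`-semigroup. -/
theorem syntactic_of_irreducible_sofic_iff_AGGM {X : Type*} [Fintype X]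
    [TopologicalSpace X] [DiscreteTopology X]
    {S : Type*} [Semigroup S] [Fintype S] (π : List X → S)
    (hπ : ∀ u v : List X, u ≠ [] → v ≠ [] → π (u ++ v) = π u * π v)
    (hsurj : ∀ s : S, ∃ w : List X, w ≠ [] ∧ π w = s) :
    (∃ 𝒳 : Set (ℤ → X), IsSubshift 𝒳 ∧ IsIrreducibleLang (shiftLang 𝒳) ∧
      Language.IsRegular (shiftLang 𝒳) ∧
      -- the kernel congruence of `π` is the syntactic congruence of `L(𝒳)`
      (∀ u v : List X, u ≠ [] → v ≠ [] →
        (π u = π v ↔ ∀ a b : List X,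
          (a ++ u ++ b ∈ shiftLang 𝒳 ↔ a ++ v ++ b ∈ shiftLang 𝒳)))) ↔
    IsAGGM S := by
  constructor
  · rintro ⟨𝒳, hsub, hirr, -, hsyn⟩
    obtain ⟨N, hN⟩ := null_of_shift π hπ hsurj 𝒳 hsub.1 hirr hsyn
    exact AGGM_of_null hN
  · intro h
    haveI : Nonempty S := ⟨π []⟩
    obtain ⟨N, hN⟩ := null_of_AGGM h
    exact shift_of_null π hπ hsurj hN
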